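/- For every real constant $c \ge 1$ there exists a sequence of connected graphs $(G_n)_{n\ge1}$ such that $\lim_{n\to\infty} F(G_n) = \lim_{n\to\infty} \mathrm{ct}(G_n)/\mathrm{dct}(G_n) = c$. -/

import Mathlib

open scoped Classical ENNReal

namespace CopsRobbers

variable {V : Type*} [Fintype V]

/-- A strategy for `k` cops on the graph `G`: an initial configuration, and a move function
producing the next configuration from the current one and the full history of robber
positions; every cop either stays or moves along an edge. -/
structure CopStrategy (G : SimpleGraph V) (k : ℕ) where
  init : Fin k → V
  move : (Fin k → V) → List V → (Fin k → V)
  move_legal : ∀ x h i, move x h i = x i ∨ G.Adj (x i) (move x h i)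

/-- A strategy for the (adversarial) robber: an initial vertex chosen after seeing the cops'
initial configuration, and a move function producing the next vertex from the current one and
the full history of cop configurations (including the cops' latest move). -/
structure RobberStrategy (G : SimpleGraph V) (k : ℕ) where
  init : (Fin k → V) → V
  move : V → List (Fin k → V) → V
  move_legal : ∀ y h, move y h = y ∨ G.Adj y (move y h)

variable {G : SimpleGraph V} {k : ℕ}

/-- The play generated by a cop strategy and a robber strategy: chronological histories
`([X_0,…,X_t], [Y_0,…,Y_t])`. In each round the cops move first, then the robber. -/
def playHist (sc : CopStrategy G k) (sr : RobberStrategy G k) : ℕ → List (Fin k → V) × List V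
  | 0 => ([sc.init], [sr.init sc.init])
  | t + 1 =>
    let h := playHist sc sr t
    let x := sc.move (h.1.getLastD sc.init) h.2
    let y := sr.move (h.2.getLastD (sr.init sc.init)) (h.1 ++ [x])
    (h.1 ++ [x], h.2 ++ [y])

/-- Cop configuration at time `t`. -/
def copAt (sc : CopStrategy G k) (sr : RobberStrategy G k) (t : ℕ) : Fin k → V :=
  ((playHist sc sr t).1).getLastD sc.init

/-- Robber position at time `t`. -/
def robAt (sc : CopStrategy G k) (sr : RobberStrategy G k) (t : ℕ) : V :=
  ((playHist sc sr t).2).getLastD (sr.init sc.init)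

/-- The robber is caught at round `t`: some cop shares his vertex either after the robber's
move, or in mid-round right after the cops' move. -/
def caught (sc : CopStrategy G k) (sr : RobberStrategy G k) (t : ℕ) : Prop :=
  (∃ i, copAt sc sr t i = robAt sc sr t) ∨
    (0 < t ∧ ∃ i, copAt sc sr t i = robAt sc sr (t - 1))

/-- Capture time of a play (`∞` if the robber is never caught). -/
noncomputable def captureTime (sc : CopStrategy G k) (sr : RobberStrategy G k) : ℝ≥0∞ :=
  ⨅ (t : ℕ) (_ : caught sc sr t), (t : ℝ≥0∞)

/-- `ct G k`: capture time of `k` cops against an adversarial robber under optimal play. -/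
noncomputable def ct (G : SimpleGraph V) (k : ℕ) : ℝ≥0∞ :=
  ⨅ sc : CopStrategy G k, ⨆ sr : RobberStrategy G k, captureTime sc sr

/-- One-step transition probability of the drunk robber's simple random walk. -/
noncomputable def stepP (G : SimpleGraph V) (u v : V) : ℝ≥0∞ :=
  if G.Adj u v then ((G.degree u : ℝ≥0∞))⁻¹ else 0

/-- Probability of a robber trajectory `y_0, …, y_t`: uniform initial vertex, then simple
random walk steps. -/
noncomputable def trajProb (G : SimpleGraph V) {t : ℕ} (y : Fin (t + 1) → V) : ℝ≥0∞ :=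
  (Fintype.card V : ℝ≥0∞)⁻¹ * ∏ i : Fin t, stepP G (y i.castSucc) (y i.succ)

/-- The cop configurations determined by a cop strategy against a given robber trajectory. -/
def copPosD (sc : CopStrategy G k) (y : ℕ → V) : ℕ → Fin k → V
  | 0 => sc.init
  | t + 1 => sc.move (copPosD sc y t) (List.ofFn fun i : Fin (t + 1) => y i)

/-- The robber trajectory `y` leads to capture at round `t`. -/
def caughtD (sc : CopStrategy G k) (y : ℕ → V) (t : ℕ) : Prop :=
  (∃ i, copPosD sc y t i = y t) ∨ (0 < t ∧ ∃ i, copPosD sc y t i = y (t - 1))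

/-- Extend a finite trajectory to an infinite one. -/
def extTraj {t : ℕ} (y : Fin (t + 1) → V) : ℕ → V :=
  fun s => y ⟨min s t, by omega⟩

/-- `survive sc t` : probability that the drunk robber is not yet caught by round `t`,
i.e. `ℙ(T > t)`. -/
noncomputable def survive (sc : CopStrategy G k) (t : ℕ) : ℝ≥0∞ :=
  ∑ y : Fin (t + 1) → V,
    if ∀ s ≤ t, ¬ caughtD sc (extTraj y) s then trajProb G y else 0

/-- `dct G k`: minimum over cop strategies of the expected capture time of the drunk robber,
computed by the tail-sum formula `𝔼T = ∑_{t≥0} ℙ(T > t)`. -/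
noncomputable def dct (G : SimpleGraph V) (k : ℕ) : ℝ≥0∞ :=
  ⨅ sc : CopStrategy G k, ∑' t : ℕ, survive sc t

/-- The cop number: the least number of cops capturing the adversarial robber. -/
noncomputable def copNumber (G : SimpleGraph V) : ℕ :=
  sInf {k | ct G k ≠ ⊤}

end CopsRobbers

namespace CopsRobbers

/-- Vertices: a path plus two large clouds. -/
abbrev BV (p M : ℕ) : Type := Fin (2 * p + 1) ⊕ (Bool × Fin (M + 1))

/-- Position of a vertex along the path. -/
def bpos (p q M : ℕ) : BV p M → ℤ
  | .inl i => (i : ℕ)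
  | .inr (false, _) => (p : ℤ) - q
  | .inr (true, _) => (p : ℤ) + q

/-- The graph. -/
def BG (p q M : ℕ) : SimpleGraph (BV p M) where
  Adj u v := u ≠ v ∧ |bpos p q M u - bpos p q M v| ≤ 1
  symm := ⟨fun u v h => ⟨h.1.symm, by rw [abs_sub_comm]; exact h.2⟩⟩
  loopless := ⟨fun _ h => h.1 rfl⟩

lemma bpos_nonneg {p q M : ℕ} (hqp : q ≤ p) (u : BV p M) : 0 ≤ bpos p q M u := by
  rcases u with i | ⟨b, j⟩
  · simp [bpos]
  · cases b <;> simp only [bpos] <;> omega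

lemma bpos_le {p q M : ℕ} (hqp : q ≤ p) (u : BV p M) : bpos p q M u ≤ 2 * p := by
  rcases u with i | ⟨b, j⟩
  · have := i.2
    simp only [bpos]; omega
  · cases b <;> simp only [bpos] <;> omega

lemma exists_bpos {p q M : ℕ} (z : ℤ) (h0 : 0 ≤ z) (h1 : z ≤ 2 * p) :
    ∃ u : BV p M, bpos p q M u = z :=
  ⟨.inl ⟨z.toNat, by omega⟩, by simp only [bpos]; omega⟩

lemma exists_nxt {p q M : ℕ} (hqp : q ≤ p) (u y : BV p M) :
    ∃ v : BV p M, (v = u ∨ (BG p q M).Adj u v) ∧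
      (|bpos p q M u - bpos p q M y| ≤ 1 → v = y) ∧
      (bpos p q M u + 1 < bpos p q M y → bpos p q M v = bpos p q M u + 1) ∧
      (bpos p q M y < bpos p q M u - 1 → bpos p q M v = bpos p q M u - 1) := by
  have hu := bpos_nonneg hqp u
  have hu' := bpos_le hqp u
  have hy := bpos_nonneg hqp y
  have hy' := bpos_le hqp y
  by_cases h : |bpos p q M u - bpos p q M y| ≤ 1
  · refine ⟨y, ?_, fun _ => rfl, ?_, ?_⟩
    · by_cases e : y = u
      · exact Or.inl e
      · exact Or.inr ⟨fun e' => e e'.symm, h⟩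
    · intro h'; rw [abs_le] at h; omega
    · intro h'; rw [abs_le] at h; omega
  · by_cases h2 : bpos p q M u < bpos p q M y
    · have : bpos p q M u + 1 < bpos p q M y := by
        by_contra h3
        exact h (abs_le.2 ⟨by omega, by omega⟩)
      obtain ⟨v, hv⟩ := exists_bpos (p := p) (q := q) (M := M) (bpos p q M u + 1)
        (by omega) (by omega)
      refine ⟨v, Or.inr ⟨?_, ?_⟩, fun h' => absurd h' h, fun _ => hv, fun _ => by omega⟩
      · rintro rfl; omega
      · rw [hv, abs_le]; constructor <;> omega
    · have : bpos p q M y < bpos p q M u - 1 := by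
        by_contra h3
        exact h (abs_le.2 ⟨by omega, by omega⟩)
      obtain ⟨v, hv⟩ := exists_bpos (p := p) (q := q) (M := M) (bpos p q M u - 1)
        (by omega) (by omega)
      refine ⟨v, Or.inr ⟨?_, ?_⟩, fun h' => absurd h' h, fun _ => by omega, fun _ => hv⟩
      · rintro rfl; omega
      · rw [hv, abs_le]; constructor <;> omega

/-- The chasing step. -/
noncomputable def nxt {p q M : ℕ} (hqp : q ≤ p) (u y : BV p M) : BV p M :=
  (exists_nxt hqp u y).choose

/-- The centre of the path. -/
def ctr (p M : ℕ) : BV p M := .inl ⟨p, by omega⟩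

/-- The chasing strategy. -/
noncomputable def chase {p q M : ℕ} (hqp : q ≤ p) : CopStrategy (BG p q M) 1 where
  init := fun _ => ctr p M
  move := fun x h i => nxt hqp (x i) (h.getLastD (ctr p M))
  move_legal := fun x h i => (exists_nxt hqp (x i) (h.getLastD (ctr p M))).choose_spec.1

/-- Analysis of the chase. -/
lemma chase_inv {p q M : ℕ} (hqp : q ≤ p) (x y : ℕ → BV p M) (h0 : x 0 = ctr p M) (T : ℕ)
    (hx : ∀ t ≤ T, x (t + 1) = nxt hqp (x t) (y t))
    (hy : ∀ t < T, |bpos p q M (y t) - bpos p q M (y (t + 1))| ≤ 1)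
    (hc : ∀ t ≤ T, x (t + 1) ≠ y t) :
    (bpos p q M (x T) = p + T ∧ (p : ℤ) + T + 2 ≤ bpos p q M (y T)) ∨
    (bpos p q M (x T) = p - T ∧ bpos p q M (y T) ≤ (p : ℤ) - T - 2) := by
  induction T with
  | zero =>
    have hp : bpos p q M (x 0) = p := by rw [h0]; simp [ctr, bpos]
    have h1 := (exists_nxt hqp (x 0) (y 0)).choose_spec.2.1
    have h2 : ¬ |bpos p q M (x 0) - bpos p q M (y 0)| ≤ 1 :=
      fun h => hc 0 le_rfl ((hx 0 le_rfl).trans (h1 h))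
    rw [abs_le] at h2
    push_cast
    omega
  | succ T ih =>
    have ih := ih (fun t ht => hx t (by omega)) (fun t ht => hy t (by omega))
      (fun t ht => hc t (by omega))
    have hxT := hx T (by omega)
    have hyT := hy T (by omega)
    have h1 := (exists_nxt hqp (x (T + 1)) (y (T + 1))).choose_spec.2.1
    have h2 : ¬ |bpos p q M (x (T + 1)) - bpos p q M (y (T + 1))| ≤ 1 :=
      fun h => hc (T + 1) le_rfl ((hx (T + 1) le_rfl).trans (h1 h))
    have h3 := (exists_nxt hqp (x T) (y T)).choose_spec.2.2
    change (_ → bpos p q M (nxt hqp (x T) (y T)) = _) ∧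
      (_ → bpos p q M (nxt hqp (x T) (y T)) = _) at h3
    rw [← hxT] at h3
    rw [abs_le] at h2 hyT
    push_cast
    omega

lemma bpos_adj {p q M : ℕ} {u v : BV p M} (h : v = u ∨ (BG p q M).Adj u v) :
    |bpos p q M u - bpos p q M v| ≤ 1 := by
  rcases h with rfl | h
  · simp
  · exact h.2

section play
variable {V : Type*} [Fintype V] {G : SimpleGraph V} {k : ℕ}

lemma copAt_succ (sc : CopStrategy G k) (sr : RobberStrategy G k) (t : ℕ) :
    copAt sc sr (t + 1) = sc.move (copAt sc sr t) (playHist sc sr t).2 := by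
  simp [copAt, playHist]

lemma robAt_succ (sc : CopStrategy G k) (sr : RobberStrategy G k) (t : ℕ) :
    robAt sc sr (t + 1) = sr.move (robAt sc sr t)
      ((playHist sc sr t).1 ++ [copAt sc sr (t + 1)]) := by
  simp [robAt, playHist, copAt]

lemma hist_getLastD (sc : CopStrategy G k) (sr : RobberStrategy G k) (t : ℕ) (d : V) :
    (playHist sc sr t).2.getLastD d = robAt sc sr t := by
  cases t <;> simp [robAt, playHist]

lemma copNumber_eq_one [Nonempty V] (h : ct G 1 ≠ ⊤) : copNumber G = 1 := by
  have h0 : ct G 0 = ⊤ := by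
    unfold ct
    rw [iInf_eq_top]
    intro sc
    have sr : RobberStrategy G 0 :=
      ⟨fun _ => Classical.arbitrary V, fun y _ => y, fun y _ => Or.inl rfl⟩
    rw [eq_top_iff]
    refine le_trans ?_ (le_iSup _ sr)
    simp [captureTime, caught]
  have hle : copNumber G ≤ 1 := Nat.sInf_le h
  have hmem : copNumber G ∈ {k | ct G k ≠ ⊤} := Nat.sInf_mem ⟨1, h⟩
  have : copNumber G ≠ 0 := by
    intro e
    rw [e] at hmem
    exact hmem h0
  omega

end play

lemma cop_pos_bound {p q M : ℕ} (x : ℕ → Fin 1 → BV p M)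
    (hx : ∀ t i, x (t + 1) i = x t i ∨ (BG p q M).Adj (x t i) (x (t + 1) i)) (t : ℕ) :
    |bpos p q M (x 0 0) - bpos p q M (x t 0)| ≤ t := by
  induction t with
  | zero => simp
  | succ t ih =>
    have := bpos_adj (hx t 0)
    rw [abs_le] at *
    push_cast
    omega

lemma ct_le {p q M : ℕ} (hqp : q ≤ p) (hp : 1 ≤ p) : ct (BG p q M) 1 ≤ p := by
  refine (iInf_le _ (chase hqp)).trans (iSup_le fun sr => ?_)
  by_contra hcon
  have hnc : ∀ t ≤ p, ¬ caught (chase hqp) sr t := by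
    intro t ht hc
    apply hcon
    refine (iInf₂_le t hc).trans ?_
    exact_mod_cast ht
  obtain ⟨m, rfl⟩ : ∃ m, p = m + 1 := ⟨p - 1, by omega⟩
  have := chase_inv hqp (fun t => copAt (chase hqp) sr t 0) (fun t => robAt (chase hqp) sr t)
    (by simp [copAt, playHist, chase]) m
    (fun t _ => by
      simp only [copAt_succ]
      simp only [chase]
      congr 1
      exact hist_getLastD _ _ _ _)
    (fun t _ => by
      apply bpos_adj
      rw [robAt_succ]
      exact sr.move_legal _ _)
    (fun t ht he => hnc (t + 1) (by omega) (Or.inr ⟨by omega, 0, by simpa using he⟩))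
  have h1 := bpos_le hqp (robAt (chase hqp) sr m)
  have h2 := bpos_nonneg hqp (robAt (chase hqp) sr m)
  push_cast at *
  omega

lemma le_ct {p q M : ℕ} : (p : ℝ≥0∞) ≤ ct (BG p q M) 1 := by
  refine le_iInf fun sc => ?_
  obtain ⟨r, hr⟩ : ∃ r : BV p M, (p : ℤ) ≤ |bpos p q M (sc.init 0) - bpos p q M r| := by
    by_cases h : bpos p q M (sc.init 0) ≤ p
    · obtain ⟨r, hr⟩ := exists_bpos (p := p) (q := q) (M := M) (2 * p) (by omega) le_rfl
      exact ⟨r, by rw [le_abs]; omega⟩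
    · obtain ⟨r, hr⟩ := exists_bpos (p := p) (q := q) (M := M) 0 le_rfl (by omega)
      exact ⟨r, by rw [le_abs]; omega⟩
  let sr : RobberStrategy (BG p q M) 1 := ⟨fun _ => r, fun y _ => y, fun y _ => Or.inl rfl⟩
  have hrob : ∀ t, robAt sc sr t = r := by
    intro t
    induction t with
    | zero => simp [robAt, playHist, sr]
    | succ t ih => rw [robAt_succ]; exact ih
  refine le_trans ?_ (le_iSup _ sr)
  refine le_iInf₂ fun t ht => ?_
  have hcop : copAt sc sr t 0 = r := by
    rcases ht with ⟨i, hi⟩ | ⟨_, i, hi⟩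
    · rw [hrob, Subsingleton.elim i 0] at hi; exact hi
    · rw [hrob, Subsingleton.elim i 0] at hi; exact hi
  have hb := cop_pos_bound (q := q) (fun t => copAt sc sr t)
    (fun t i => by simp only [copAt_succ]; exact sc.move_legal _ _ _) t
  have h0 : copAt sc sr 0 = sc.init := by simp [copAt, playHist]
  simp only [h0, hcop] at hb
  exact_mod_cast hr.trans hb

lemma ct_eq {p q M : ℕ} (hqp : q ≤ p) (hp : 1 ≤ p) : ct (BG p q M) 1 = p :=
  le_antisymm (ct_le hqp hp) le_ct

section traj
variable {V : Type*} [Fintype V] {G : SimpleGraph V}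

/-- weight of a trajectory -/
noncomputable def wt (G : SimpleGraph V) {t : ℕ} (y : Fin (t + 1) → V) : ℝ≥0∞ :=
  ∏ i : Fin t, stepP G (y i.castSucc) (y i.succ)

lemma wt_snoc {t : ℕ} (y : Fin (t + 1) → V) (v : V) :
    wt G (Fin.snoc (α := fun _ => V) y v : Fin (t + 2) → V)
      = wt G y * stepP G (y (Fin.last t)) v := by
  unfold wt
  rw [Fin.prod_univ_castSucc]
  congr 1
  · refine Finset.prod_congr rfl fun i _ => ?_
    rw [← Fin.castSucc_succ i]
    simp only [Fin.snoc_castSucc]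
  · simp only [Fin.snoc_castSucc]
    rw [Fin.succ_last, Fin.snoc_last]

lemma sum_snoc {t : ℕ} (f : (Fin (t + 2) → V) → ℝ≥0∞) :
    ∑ y, f y = ∑ y : Fin (t + 1) → V, ∑ v : V, f (Fin.snoc (α := fun _ => V) y v) := by
  rw [← (Fin.snocEquiv (fun _ : Fin (t + 2) => V)).sum_comp, Fintype.sum_prod_type,
    Finset.sum_comm]
  rfl

lemma stepP_sum_le (u : V) : ∑ v, stepP G u v ≤ 1 := by
  unfold stepP
  rw [← Finset.sum_filter, Finset.sum_const, nsmul_eq_mul]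
  have : (Finset.univ.filter fun v => G.Adj u v).card = G.degree u := by
    rw [← SimpleGraph.card_neighborFinset_eq_degree]
    congr 1
    ext v
    simp
  rw [this]
  exact ENNReal.mul_inv_le_one _

lemma wt_sum_le (t : ℕ) : ∑ y : Fin (t + 1) → V, wt G y ≤ Fintype.card V := by
  induction t with
  | zero => simp [wt]
  | succ t ih =>
    rw [sum_snoc]
    refine le_trans (Finset.sum_le_sum fun y _ => ?_) ih
    simp only [wt_snoc]
    rw [← Finset.mul_sum]
    exact mul_le_of_le_one_right' (stepP_sum_le _)

lemma stay_le (A : V → Prop) (ρ : ℝ≥0∞)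
    (hρ : ∀ u, A u → ρ ≤ ∑ v, if A v then stepP G u v else 0) (t : ℕ) :
    ((Finset.univ.filter A).card : ℝ≥0∞) * ρ ^ t ≤
      ∑ y : Fin (t + 1) → V, if ∀ i, A (y i) then wt G y else 0 := by
  induction t with
  | zero =>
    rw [← (Equiv.funUnique (Fin 1) V).symm.sum_comp]
    simp [wt]
  | succ t ih =>
    rw [sum_snoc, pow_succ, ← mul_assoc]
    refine le_trans (mul_le_mul_left ih ρ) ?_
    rw [Finset.sum_mul]
    refine Finset.sum_le_sum fun y _ => ?_
    split_ifs with h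
    · refine le_trans (mul_le_mul_right (hρ _ (h (Fin.last t))) (wt G y)) ?_
      rw [Finset.mul_sum]
      refine Finset.sum_le_sum fun v _ => ?_
      by_cases hv : A v
      · rw [if_pos hv, if_pos, wt_snoc]
        intro i
        refine Fin.lastCases ?_ (fun j => ?_) i
        · simpa using hv
        · simpa using h j
      · simp [hv]
    · simp

lemma trajProb_eq {t : ℕ} (y : Fin (t + 1) → V) :
    trajProb G y = (Fintype.card V : ℝ≥0∞)⁻¹ * wt G y := rfl

lemma trajProb_sum_le (t : ℕ) : ∑ y : Fin (t + 1) → V, trajProb G y ≤ 1 := by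
  simp only [trajProb_eq]
  rw [← Finset.mul_sum]
  refine le_trans (mul_le_mul_right (wt_sum_le t) _) ?_
  rw [mul_comm]
  exact ENNReal.mul_inv_le_one _

lemma stay_trajProb (A : V → Prop) (ρ : ℝ≥0∞)
    (hρ : ∀ u, A u → ρ ≤ ∑ v, if A v then stepP G u v else 0) (t : ℕ) :
    (Fintype.card V : ℝ≥0∞)⁻¹ * (((Finset.univ.filter A).card : ℝ≥0∞) * ρ ^ t) ≤
      ∑ y : Fin (t + 1) → V, if ∀ i, A (y i) then trajProb G y else 0 := by
  refine le_trans (mul_le_mul_right (stay_le A ρ hρ t) _) ?_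
  rw [Finset.mul_sum]
  refine Finset.sum_le_sum fun y _ => ?_
  split_ifs
  · exact le_rfl
  · simp

lemma adj_of_trajProb {t : ℕ} {y : Fin (t + 1) → V} (h : trajProb G y ≠ 0) (i : Fin t) :
    G.Adj (y i.castSucc) (y i.succ) := by
  by_contra hn
  apply h
  rw [trajProb_eq, wt, Finset.prod_eq_zero (Finset.mem_univ i), mul_zero]
  simp [stepP, hn]

lemma extTraj_adj {t : ℕ} {y : Fin (t + 1) → V} (h : trajProb G y ≠ 0) (s : ℕ) :
    extTraj y (s + 1) = extTraj y s ∨ G.Adj (extTraj y s) (extTraj y (s + 1)) := by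
  by_cases hs : s < t
  · right
    have := adj_of_trajProb h ⟨s, hs⟩
    have e1 : extTraj y s = y (Fin.castSucc ⟨s, hs⟩) := by
      unfold extTraj
      congr 1
      ext
      simp only [Fin.val_castSucc]
      omega
    have e2 : extTraj y (s + 1) = y (Fin.succ ⟨s, hs⟩) := by
      unfold extTraj
      congr 1
      ext
      simp only [Fin.val_succ]
      omega
    rw [e1, e2]
    exact this
  · left
    unfold extTraj
    congr 2
    omega

end traj

/-- The cloud on side `b`. -/
def cloud {p M : ℕ} (b : Bool) (u : BV p M) : Prop := ∃ j, u = .inr (b, j)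

lemma cloud_card {p M : ℕ} (b : Bool) :
    (Finset.univ.filter (cloud (p := p) (M := M) b)).card = M + 1 := by
  have : Finset.univ.filter (cloud (p := p) (M := M) b) =
      Finset.univ.image (fun j : Fin (M + 1) => (Sum.inr (b, j) : BV p M)) := by
    ext u
    simp [cloud, eq_comm]
  rw [this, Finset.card_image_of_injective, Finset.card_univ, Fintype.card_fin]
  intro i j h
  simpa using h

lemma cloud_degree {p q M : ℕ} (hq : 1 ≤ q) (b : Bool) (j : Fin (M + 1)) :
    (BG p q M).degree (.inr (b, j)) ≤ M + 1 + (2 * p + 1) := by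
  rw [← SimpleGraph.card_neighborFinset_eq_degree]
  calc _ ≤ (Finset.univ.image (Sum.inl : _ → BV p M) ∪
        Finset.univ.image (fun j : Fin (M + 1) => (Sum.inr (b, j) : BV p M))).card := by
        apply Finset.card_le_card
        intro u hu
        rw [SimpleGraph.mem_neighborFinset] at hu
        rcases u with i | ⟨b', j'⟩
        · simp
        · have hb : b' = b := by
            have h2 := hu.2
            rw [abs_le] at h2
            cases b <;> cases b' <;> simp [bpos] at h2 ⊢ <;> omega
          subst hb
          simp
    _ ≤ (2 * p + 1) + (M + 1) := by
        refine (Finset.card_union_le _ _).trans ?_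
        gcongr
        · exact Finset.card_image_le.trans (by simp)
        · exact Finset.card_image_le.trans (by simp)
    _ = _ := by omega

lemma cloud_stay {p q M : ℕ} (hq : 1 ≤ q) (b : Bool) (u : BV p M) (hu : cloud b u) :
    (M : ℝ≥0∞) * ((M + 1 + (2 * p + 1) : ℕ) : ℝ≥0∞)⁻¹ ≤
      ∑ v, if cloud b v then stepP (BG p q M) u v else 0 := by
  obtain ⟨j, rfl⟩ := hu
  have hsub : (Finset.univ.filter fun v : BV p M => cloud b v ∧ v ≠ .inr (b, j)).card = M := by
    have : (Finset.univ.filter fun v : BV p M => cloud b v ∧ v ≠ .inr (b, j)) =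
      (Finset.univ.filter (cloud (p := p) (M := M) b)).erase (.inr (b, j)) := by
      ext v; simp [and_comm]
    rw [this, Finset.card_erase_of_mem, cloud_card]
    · rfl
    · simp [cloud]
  calc _ = ∑ v : BV p M, if cloud b v ∧ v ≠ .inr (b, j) then
        ((M + 1 + (2 * p + 1) : ℕ) : ℝ≥0∞)⁻¹ else 0 := by
        rw [← Finset.sum_filter, Finset.sum_const, hsub, nsmul_eq_mul]
    _ ≤ _ := by
        refine Finset.sum_le_sum fun v _ => ?_
        split_ifs with h1 h2 h2
        · obtain ⟨⟨j', rfl⟩, h1⟩ := h1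
          have hadj : (BG p q M).Adj (.inr (b, j)) (.inr (b, j')) := by
            refine ⟨fun e => h1 e.symm, ?_⟩
            cases b <;> simp [bpos]
          rw [stepP, if_pos hadj]
          exact ENNReal.inv_le_inv.2 (by exact_mod_cast cloud_degree hq b j)
        · exact absurd h1.1 h2
        · exact zero_le
        · exact le_rfl

/-- Lower bound for the probability to stay in a given cloud. -/
noncomputable def gg (p M : ℕ) : ℝ≥0∞ :=
  (Fintype.card (BV p M) : ℝ≥0∞)⁻¹ *
    (((M + 1 : ℕ) : ℝ≥0∞) * ((M : ℝ≥0∞) * ((M + 1 + (2 * p + 1) : ℕ) : ℝ≥0∞)⁻¹) ^ (2 * p))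

lemma gg_le {p q M : ℕ} (hq : 1 ≤ q) (b : Bool) (t : ℕ) (ht : t ≤ 2 * p) :
    gg p M ≤ ∑ y : Fin (t + 1) → BV p M,
      if ∀ i, cloud b (y i) then trajProb (BG p q M) y else 0 := by
  refine le_trans ?_ (stay_trajProb (cloud b) _ (cloud_stay hq b) t)
  rw [cloud_card]
  unfold gg
  refine mul_le_mul_right (mul_le_mul_right (pow_le_pow_right_of_le_one' ?_ ht) _) _
  rw [← div_eq_mul_inv]
  refine ENNReal.div_le_of_le_mul ?_
  rw [one_mul]
  exact_mod_cast (by omega)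

lemma cloud_bpos {p q M : ℕ} {b : Bool} {u : BV p M} (h : cloud b u) :
    bpos p q M u = if b then (p : ℤ) + q else p - q := by
  obtain ⟨j, rfl⟩ := h
  cases b <;> simp [bpos]

lemma cloud_disj {p M : ℕ} {u : BV p M} (h : cloud false u) (h' : cloud true u) : False := by
  obtain ⟨j, rfl⟩ := h
  obtain ⟨j', h'⟩ := h'
  simp at h'

lemma chaseD_inv {p q M : ℕ} (hqp : q ≤ p) {t : ℕ} {y : Fin (t + 2) → BV p M}
    (h : trajProb (BG p q M) y ≠ 0)
    (hc : ∀ s ≤ t + 1, ¬ caughtD (chase hqp) (extTraj y) s) :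
    ((p : ℤ) + t + 2 ≤ bpos p q M (extTraj y t)) ∨
      (bpos p q M (extTraj y t) ≤ (p : ℤ) - t - 2) := by
  have := chase_inv hqp (fun s => copPosD (chase hqp) (extTraj y) s 0) (extTraj y)
    rfl t
    (fun s _ => by
      simp only [copPosD]
      simp only [chase]
      congr 1
      rw [List.ofFn_succ']
      simp)
    (fun s _ => bpos_adj (extTraj_adj h s))
    (fun s hs he => hc (s + 1) (by omega) (Or.inr ⟨by omega, 0, by simpa using he⟩))
  omega

lemma survive_le_one {V : Type*} [Fintype V] {G : SimpleGraph V} {k : ℕ}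
    (sc : CopStrategy G k) (t : ℕ) : survive sc t ≤ 1 := by
  refine le_trans (Finset.sum_le_sum fun y _ => ?_) (trajProb_sum_le (G := G) t)
  split_ifs
  · exact le_rfl
  · exact zero_le

lemma survive_chase_zero {p q M : ℕ} (hqp : q ≤ p) (hp : 1 ≤ p) (t : ℕ) (ht : p ≤ t) :
    survive (chase (M := M) hqp) t = 0 := by
  obtain ⟨t, rfl⟩ : ∃ s, t = s + 1 := ⟨t - 1, by omega⟩
  refine Finset.sum_eq_zero fun y _ => ?_
  split_ifs with hc
  · by_contra h
    have h1 := chaseD_inv hqp h hc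
    have h2 := bpos_le hqp (extTraj y t)
    have h3 := bpos_nonneg hqp (extTraj y t)
    omega
  · rfl

lemma survive_chase_mid {p q M : ℕ} (hqp : q ≤ p) (hq : 1 ≤ q) (t : ℕ) (ht : q ≤ t)
    (htp : t < p) : survive (chase (M := M) hqp) t + 2 * gg p M ≤ 1 := by
  obtain ⟨t, rfl⟩ : ∃ s, t = s + 1 := ⟨t - 1, by omega⟩
  have hf := gg_le (p := p) (M := M) hq false (t + 1) (by omega)
  have hT := gg_le (p := p) (M := M) hq true (t + 1) (by omega)
  rw [two_mul (gg p M)]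
  refine le_trans (add_le_add_right (add_le_add hf hT) _) ?_
  unfold survive
  rw [← Finset.sum_add_distrib, ← Finset.sum_add_distrib]
  refine le_trans (Finset.sum_le_sum fun y _ => ?_)
    (trajProb_sum_le (G := BG p q M) (t + 1))
  by_cases h : trajProb (BG p q M) y = 0
  · simp [h]
  by_cases h1 : ∀ i, cloud false (y i)
  · have h2 : ¬ ∀ i, cloud true (y i) := fun h2 => cloud_disj (h1 0) (h2 0)
    have h3 : ¬ ∀ s ≤ t + 1, ¬ caughtD (chase hqp) (extTraj y) s := by
      intro hc
      have h4 := chaseD_inv hqp h hc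
      have h5 : bpos p q M (extTraj y t) = _ := cloud_bpos (h1 _)
      simp at h5
      omega
    rw [if_neg h3, if_pos h1, if_neg h2]; simp
  · by_cases h2 : ∀ i, cloud true (y i)
    · have h3 : ¬ ∀ s ≤ t + 1, ¬ caughtD (chase hqp) (extTraj y) s := by
        intro hc
        have h4 := chaseD_inv hqp h hc
        have h5 : bpos p q M (extTraj y t) = _ := cloud_bpos (h2 _)
        simp at h5
        omega
      rw [if_neg h3, if_neg h1, if_pos h2]; simp
    · rw [if_neg h1, if_neg h2]
      split_ifs <;> simp

lemma gg_ne_top {p M : ℕ} : gg p M ≠ ⊤ := by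
  have h := gg_le (p := p) (q := 1) (M := M) le_rfl false 0 (by omega)
  have h2 : (∑ y : Fin (0 + 1) → BV p M,
      if ∀ i, cloud false (y i) then trajProb (BG p 1 M) y else 0) ≤ 1 := by
    refine le_trans (Finset.sum_le_sum fun y _ => ?_) (trajProb_sum_le (G := BG p 1 M) 0)
    split_ifs
    · exact le_rfl
    · exact zero_le
  exact ne_top_of_le_ne_top ENNReal.one_ne_top (h.trans h2)

lemma dct_le {p q M : ℕ} (hqp : q ≤ p) (hq : 1 ≤ q) (δ : ℝ≥0∞) (hδ : 1 ≤ 2 * gg p M + δ)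
    (hδ' : p * δ ≤ 1) : dct (BG p q M) 1 ≤ q + 1 := by
  refine (iInf_le _ (chase hqp)).trans ?_
  rw [tsum_eq_sum (s := Finset.range p) (fun t ht => survive_chase_zero hqp (by omega) t
    (by simpa using ht))]
  calc _ ≤ ∑ t ∈ Finset.range p, ((if t < q then (1 : ℝ≥0∞) else 0) + δ) := by
        refine Finset.sum_le_sum fun t ht => ?_
        rw [Finset.mem_range] at ht
        split_ifs with h
        · exact (survive_le_one _ _).trans le_self_add
        · rw [zero_add]
          have h1 := (survive_chase_mid (M := M) hqp hq t (by omega) ht).trans hδ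
          rw [add_comm] at h1
          exact (ENNReal.add_le_add_iff_left
            (ENNReal.mul_ne_top (by simp) gg_ne_top)).1 h1
    _ = q + p * δ := by
        rw [Finset.sum_add_distrib]
        congr 1
        · rw [← Finset.sum_filter, Finset.sum_const, nsmul_eq_mul, mul_one]
          congr 1
          have : (Finset.range p).filter (fun t => t < q) = Finset.range q := by
            ext t; simp; omega
          rw [this, Finset.card_range]
        · simp
    _ ≤ q + 1 := by gcongr

lemma sum_lt_bound (a n : ℕ) (h : a ≤ n) (g : ℝ≥0∞) :
    ∑ t ∈ Finset.range n, (if t < a then g else 0) = a * g := by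
  rw [← Finset.sum_filter, Finset.sum_const, nsmul_eq_mul]
  congr 2
  have : (Finset.range n).filter (fun t => t < a) = Finset.range a := by
    ext t; simp; omega
  rw [this, Finset.card_range]

lemma uncaught_of_cloud {p q M : ℕ} (sc : CopStrategy (BG p q M) 1) (b : Bool) {t : ℕ}
    (y : Fin (t + 1) → BV p M) (hy : ∀ i, cloud b (y i))
    (ht : (t : ℤ) < |bpos p q M (sc.init 0) - (if b then (p : ℤ) + q else p - q)|) :
    ∀ s ≤ t, ¬ caughtD sc (extTraj y) s := by
  intro s hs hc
  have hb := cop_pos_bound (q := q) (copPosD sc (extTraj y))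
    (fun t i => sc.move_legal _ _ _) s
  have hpos : bpos p q M (copPosD sc (extTraj y) s 0) = if b then (p : ℤ) + q else p - q := by
    rcases hc with ⟨i, hi⟩ | ⟨_, i, hi⟩
    · rw [Subsingleton.elim 0 i, hi]; exact cloud_bpos (hy _)
    · rw [Subsingleton.elim 0 i, hi]; exact cloud_bpos (hy _)
  rw [hpos] at hb
  change |bpos p q M (sc.init 0) - _| ≤ _ at hb
  omega

lemma le_dct {p q M : ℕ} (hqp : q ≤ p) (hq : 1 ≤ q) : q * (2 * gg p M) ≤ dct (BG p q M) 1 := by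
  refine le_iInf fun sc => ?_
  set x := bpos p q M (sc.init 0) with hx
  have hx0 := bpos_nonneg hqp (sc.init 0)
  have hx1 := bpos_le hqp (sc.init 0)
  rw [← hx] at hx0 hx1
  set a := (x - (p - q)).natAbs with ha
  set b := (x - (p + q)).natAbs with hb
  have hab : 2 * q ≤ a + b := by omega
  refine le_trans ?_ (ENNReal.sum_le_tsum (Finset.range (2 * p)))
  calc q * (2 * gg p M) = ((2 * q : ℕ) : ℝ≥0∞) * gg p M := by push_cast; ring
    _ ≤ ((a + b : ℕ) : ℝ≥0∞) * gg p M := by gcongr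
    _ = ∑ t ∈ Finset.range (2 * p),
        ((if t < a then gg p M else 0) + (if t < b then gg p M else 0)) := by
        rw [Finset.sum_add_distrib, sum_lt_bound _ _ (by omega), sum_lt_bound _ _ (by omega)]
        push_cast; ring
    _ ≤ _ := by
        refine Finset.sum_le_sum fun t ht => ?_
        rw [Finset.mem_range] at ht
        have hf := gg_le (p := p) (M := M) hq false t (by omega)
        have hT := gg_le (p := p) (M := M) hq true t (by omega)
        have h1 : (if t < a then gg p M else 0) ≤ ∑ y : Fin (t + 1) → BV p M,
            if t < a ∧ ∀ i, cloud false (y i) then trajProb (BG p q M) y else 0 := by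
          split_ifs with h
          · simpa [h] using hf
          · exact zero_le
        have h2 : (if t < b then gg p M else 0) ≤ ∑ y : Fin (t + 1) → BV p M,
            if t < b ∧ ∀ i, cloud true (y i) then trajProb (BG p q M) y else 0 := by
          split_ifs with h
          · simpa [h] using hT
          · exact zero_le
        refine (add_le_add h1 h2).trans ?_
        rw [← Finset.sum_add_distrib]
        refine Finset.sum_le_sum fun y _ => ?_
        by_cases c1 : t < a ∧ ∀ i, cloud false (y i)
        · have c2 : ¬ (t < b ∧ ∀ i, cloud true (y i)) :=
            fun c2 => cloud_disj (c1.2 0) (c2.2 0)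
          rw [if_pos c1, if_neg c2, add_zero, if_pos]
          refine uncaught_of_cloud sc false y c1.2 ?_
          have := c1.1
          simp only [← hx, Bool.false_eq_true, if_false, Int.abs_eq_natAbs]
          omega
        · rw [if_neg c1, zero_add]
          by_cases c2 : t < b ∧ ∀ i, cloud true (y i)
          · rw [if_pos c2, if_pos]
            refine uncaught_of_cloud sc true y c2.2 ?_
            have := c2.1
            simp only [← hx, if_true, Int.abs_eq_natAbs]
            omega
          · rw [if_neg c2]; exact zero_le

lemma BG_connected {p q M : ℕ} (hqp : q ≤ p) : (BG p q M).Connected := by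
  have key : ∀ n : ℕ, ∀ u v : BV p M, |bpos p q M u - bpos p q M v| ≤ n →
      (BG p q M).Reachable u v := by
    intro n
    induction n with
    | zero =>
      intro u v h
      by_cases e : u = v
      · rw [e]
      · exact SimpleGraph.Adj.reachable ⟨e, h.trans (by norm_num)⟩
    | succ n ih =>
      intro u v h
      obtain ⟨w, hw, h1, h2, h3⟩ := exists_nxt hqp u v
      have huw : (BG p q M).Reachable u w := by
        rcases hw with rfl | hw
        · exact SimpleGraph.Reachable.refl _
        · exact hw.reachable
      refine huw.trans (ih w v ?_)
      by_cases h4 : |bpos p q M u - bpos p q M v| ≤ 1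
      · rw [h1 h4]; simp
      · rw [abs_le] at h h4 ⊢
        push_cast at h
        omega
  have : Nonempty (BV p M) := ⟨ctr p M⟩
  exact ⟨fun u v => key (|bpos p q M u - bpos p q M v|).toNat u v (by simp)⟩

lemma exists_M (p : ℕ) (hp : 1 ≤ p) : ∃ M : ℕ, 1 ≤ 2 * gg p M + (p : ℝ≥0∞)⁻¹ := by
  have h1 : Filter.Tendsto (fun M : ℕ => (((M + 1 : ℕ) : ℝ) / (((M + 1 : ℕ) : ℝ) +
      (2 * p + 1) / 2)) * ((M : ℝ) / (M + (2 * p + 2))) ^ (2 * p)) Filter.atTop (nhds 1) := by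
    have a := (tendsto_natCast_div_add_atTop ((2 * p + 1 : ℝ) / 2)).comp
      (Filter.tendsto_add_atTop_nat 1)
    have b := (tendsto_natCast_div_add_atTop (2 * p + 2 : ℝ)).pow (2 * p)
    simpa using a.mul b
  have hp' : (0 : ℝ) < (p : ℝ)⁻¹ := by positivity
  obtain ⟨M, hM⟩ := (h1.eventually (lt_mem_nhds (show (1 - (p : ℝ)⁻¹ : ℝ) < 1 by linarith))).exists
  refine ⟨M, ?_⟩
  have hg : 2 * gg p M = ENNReal.ofReal ((((M + 1 : ℕ) : ℝ) / (((M + 1 : ℕ) : ℝ) +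
      (2 * p + 1) / 2)) * ((M : ℝ) / (M + (2 * p + 2))) ^ (2 * p)) := by
    have hcard : Fintype.card (BV p M) = 2 * p + 1 + 2 * (M + 1) := by simp
    unfold gg
    rw [hcard, ENNReal.ofReal_mul (by positivity), ENNReal.ofReal_pow (by positivity)]
    have e1 : ((M : ℝ≥0∞) * ((M + 1 + (2 * p + 1) : ℕ) : ℝ≥0∞)⁻¹) =
        ENNReal.ofReal ((M : ℝ) / (M + (2 * p + 2))) := by
      rw [ENNReal.ofReal_div_of_pos (by positivity), div_eq_mul_inv, ENNReal.ofReal_natCast]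
      congr 2
      rw [← ENNReal.ofReal_natCast]
      congr 1
      push_cast; ring
    have e2 : 2 * (((2 * p + 1 + 2 * (M + 1) : ℕ) : ℝ≥0∞)⁻¹ * ((M + 1 : ℕ) : ℝ≥0∞)) =
        ENNReal.ofReal (((M + 1 : ℕ) : ℝ) / (((M + 1 : ℕ) : ℝ) + (2 * p + 1) / 2)) := by
      have : (((M + 1 : ℕ) : ℝ) / (((M + 1 : ℕ) : ℝ) + (2 * p + 1) / 2)) =
          ((2 * (M + 1) : ℕ) : ℝ) / ((2 * p + 1 + 2 * (M + 1) : ℕ) : ℝ) := by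
        push_cast
        field_simp
        ring
      rw [this, ENNReal.ofReal_div_of_pos (by positivity), div_eq_mul_inv,
        ENNReal.ofReal_natCast, ENNReal.ofReal_natCast]
      push_cast
      ring
    rw [← e1, ← e2]
    ring
  have hd : (p : ℝ≥0∞)⁻¹ = ENNReal.ofReal ((p : ℝ)⁻¹) := by
    rw [ENNReal.ofReal_inv_of_pos (by positivity), ENNReal.ofReal_natCast]
  rw [hg, hd, ← ENNReal.ofReal_add (by positivity) (by positivity)]
  rw [ENNReal.one_le_ofReal]
  linarith

lemma exists_graph (p q : ℕ) (hqp : q ≤ p) (hq : 1 ≤ q) :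
    ∃ M : ℕ, (BG p q M).Connected ∧ (ct (BG p q M) (copNumber (BG p q M))).toReal = p ∧
      (q : ℝ) - 1 ≤ (dct (BG p q M) (copNumber (BG p q M))).toReal ∧
      (dct (BG p q M) (copNumber (BG p q M))).toReal ≤ q + 1 := by
  obtain ⟨M, hM⟩ := exists_M p (by omega)
  have hct := ct_eq (M := M) hqp (by omega)
  have : Nonempty (BV p M) := ⟨ctr p M⟩
  have hcn : copNumber (BG p q M) = 1 :=
    copNumber_eq_one (by rw [hct]; exact ENNReal.natCast_ne_top p)
  have hpδ : (p : ℝ≥0∞) * (p : ℝ≥0∞)⁻¹ ≤ 1 := ENNReal.mul_inv_le_one _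
  have hu := dct_le hqp hq _ hM hpδ
  have hfin : dct (BG p q M) 1 ≠ ⊤ := ne_top_of_le_ne_top (by finiteness) hu
  refine ⟨M, BG_connected hqp, ?_, ?_, ?_⟩
  · rw [hcn, hct]; simp
  · rw [hcn]
    have hl : (q : ℝ≥0∞) ≤ dct (BG p q M) 1 + 1 := by
      calc (q : ℝ≥0∞) = q * 1 := (mul_one _).symm
        _ ≤ q * (2 * gg p M + (p : ℝ≥0∞)⁻¹) := by gcongr
        _ = q * (2 * gg p M) + q * (p : ℝ≥0∞)⁻¹ := mul_add _ _ _
        _ ≤ dct (BG p q M) 1 + 1 := by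
          refine add_le_add (le_dct hqp hq) (le_trans ?_ hpδ)
          gcongr
    have := ENNReal.toReal_mono (by finiteness) hl
    rw [ENNReal.toReal_add hfin (by simp)] at this
    simp at this
    linarith
  · rw [hcn]
    have := ENNReal.toReal_mono (by finiteness) hu
    rw [ENNReal.toReal_add (by simp) (by simp)] at this
    simpa using this

end CopsRobbers

open Filter

/-- for every real constant `c ≥ 1` there is a sequence of connected (finite)
graphs `(G_n)` whose cost of drunkenness `F(G_n) = ct(G_n)/dct(G_n)` (with `c(G_n)` cops,
where `c(G)` is the cop number) tends to `c`. -/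
theorem exists_graphs_cost_of_drunkenness_tendsto (c : ℝ) (hc : 1 ≤ c) :
    ∃ (Vn : ℕ → Type) (inst : ∀ n, Fintype (Vn n)) (Gn : ∀ n, SimpleGraph (Vn n)),
      (∀ n, (Gn n).Connected) ∧
        Tendsto
          (fun n : ℕ =>
            letI := inst n
            (CopsRobbers.ct (Gn n) (CopsRobbers.copNumber (Gn n))).toReal /
              (CopsRobbers.dct (Gn n) (CopsRobbers.copNumber (Gn n))).toReal)
          atTop (nhds c) := by
  have hfl : ∀ n : ℕ, n + 2 ≤ ⌊c * ((n + 2 : ℕ) : ℝ)⌋₊ := by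
    intro n
    apply Nat.le_floor
    have : (0 : ℝ) ≤ ((n + 2 : ℕ) : ℝ) := by positivity
    nlinarith
  choose M h1 h2 h3 h4 using fun n : ℕ =>
    CopsRobbers.exists_graph ⌊c * ((n + 2 : ℕ) : ℝ)⌋₊ (n + 2) (hfl n) (by omega)
  refine ⟨fun n => CopsRobbers.BV ⌊c * ((n + 2 : ℕ) : ℝ)⌋₊ (M n), fun n => inferInstance,
    fun n => CopsRobbers.BG ⌊c * ((n + 2 : ℕ) : ℝ)⌋₊ (n + 2) (M n), h1, ?_⟩
  have hinv : ∀ x : ℝ, Tendsto (fun n : ℕ => (n : ℝ) / (n + x)) atTop (nhds 1) :=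
    fun x => tendsto_natCast_div_add_atTop x
  have hz : ∀ x : ℝ, Tendsto (fun n : ℕ => x / ((n : ℝ) + 1)) atTop (nhds 0) := fun x =>
    tendsto_const_nhds.div_atTop (tendsto_atTop_add_const_right _ _ tendsto_natCast_atTop_atTop)
  have hz3 : ∀ x : ℝ, Tendsto (fun n : ℕ => x / ((n : ℝ) + 3)) atTop (nhds 0) := fun x =>
    tendsto_const_nhds.div_atTop (tendsto_atTop_add_const_right _ _ tendsto_natCast_atTop_atTop)
  have hlow : Tendsto (fun n : ℕ => c - (c + 1) / ((n : ℝ) + 3)) atTop (nhds c) := by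
    simpa using (tendsto_const_nhds (x := c)).sub (hz3 (c + 1))
  have hup : Tendsto (fun n : ℕ => c + c / ((n : ℝ) + 1)) atTop (nhds c) := by
    simpa using (tendsto_const_nhds (x := c)).add (hz c)
  refine tendsto_of_tendsto_of_tendsto_of_le_of_le hlow hup (fun n => ?_) (fun n => ?_)
  · have a3 := h3 n
    have a4 := h4 n
    have hf := Nat.lt_floor_add_one (c * ((n + 2 : ℕ) : ℝ))
    dsimp only
    rw [h2 n]
    push_cast at *
    have hn : (0 : ℝ) ≤ n := by positivity
    rw [le_div_iff₀ (by linarith)]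
    have hpos : 0 ≤ c - (c + 1) / ((n : ℝ) + 3) := by
      rw [sub_nonneg, div_le_iff₀ (by positivity)]
      nlinarith
    refine (mul_le_mul_of_nonneg_left a4 hpos).trans ?_
    have : (c - (c + 1) / ((n : ℝ) + 3)) * ((n : ℝ) + 2 + 1) = c * (n + 2) - 1 := by
      field_simp
      ring
    rw [this]
    linarith
  · have a3 := h3 n
    have a4 := h4 n
    have hf := Nat.floor_le (show 0 ≤ c * ((n + 2 : ℕ) : ℝ) by positivity)
    dsimp only
    rw [h2 n]
    push_cast at *
    have hn : (0 : ℝ) ≤ n := by positivity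
    rw [div_le_iff₀ (by linarith)]
    have hpos : 0 ≤ c + c / ((n : ℝ) + 1) := by positivity
    refine le_trans ?_ (mul_le_mul_of_nonneg_left a3 hpos)
    have : (c + c / ((n : ℝ) + 1)) * ((n : ℝ) + 2 - 1) = c * (n + 2) := by
      field_simp
      ring
    rw [this]
    exact hf
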